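/- arXiv:math-ph/0609079 — 2 statements merged into one kernel-verified Lean document; each statement's English description precedes it below -/
import Mathlib

section
/- Fourier–Laplace transform of a distribution of exponential growth supported in a cone: let C ⊂ ℝⁿ be an open convex cone, C′ ⋐ C, and δ > 0 with ⟨ξ,y⟩ ≥ δ|ξ||y| for all ξ ∈ C*, y ∈ C′. Let k ≥ 0, let γ be a multi-index, and let g be a bounded continuous function on ℝⁿ with supp g ⊆ C*. Then there exists r > 0 such that the function f(z) = (2π)^{−n} (−iz)^γ ∫_{ℝⁿ} e^{k|ξ|₁} g(ξ) e^{i⟨ξ,z⟩} dξ (the integral converging absolutely) is well defined and holomorphic on the truncated tube {z = x+iy ∈ ℂⁿ : y ∈ C′, |y| ≥ r}, and there exists M > 0 (depending on C′ and r) such that |f(z)| ≤ M (1+|z|)^{|γ|} for all such z. -/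
open MeasureTheory Complex Filter Topology

noncomputable section

/-- Partial derivative in the `i`-th coordinate direction. -/
def pd {n : ℕ} (i : Fin n) (f : (Fin n → ℝ) → ℂ) : (Fin n → ℝ) → ℂ :=
  fun x => fderiv ℝ f x (Pi.single i 1)

/-- Multi-index derivative `D^α`. -/
def Dm {n : ℕ} (α : Fin n → ℕ) (f : (Fin n → ℝ) → ℂ) : (Fin n → ℝ) → ℂ :=
  (List.finRange n).foldr (fun i g => (pd i)^[α i] g) f

/-- Order `|α|` of a multi-index. -/
def mOrd {n : ℕ} (α : Fin n → ℕ) : ℕ := ∑ i, α i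

/-- Supporting function `h_K(ξ) = sup_{x ∈ K} ⟨ξ,x⟩` of a set `K`. -/
def hSupp {n : ℕ} (K : Set (Fin n → ℝ)) (ξ : Fin n → ℝ) : ℝ :=
  sSup ((fun x => ∑ i, ξ i * x i) '' K)

/-- The ℓ¹ norm `|ξ|₁ = ∑ i |ξ i|`. -/
def n1 {n : ℕ} (ξ : Fin n → ℝ) : ℝ := ∑ i, |ξ i|

/-- The vector of imaginary parts of `z ∈ ℂⁿ`. -/
def imv {n : ℕ} (z : Fin n → ℂ) : Fin n → ℝ := fun i => (z i).im

/-- Euclidean norm `|z|` on `ℂⁿ`. -/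
def cnorm {n : ℕ} (z : Fin n → ℂ) : ℝ := Real.sqrt (∑ i, ‖z i‖ ^ 2)

/-- Euclidean norm on `ℝⁿ`. -/
def en {n : ℕ} (y : Fin n → ℝ) : ℝ := Real.sqrt (∑ i, y i ^ 2)

/-- `C` is a cone with vertex at the origin: `ℝ₊ · C ⊆ C`. -/
def IsCone {n : ℕ} (C : Set (Fin n → ℝ)) : Prop :=
  ∀ t : ℝ, 0 < t → ∀ x ∈ C, t • x ∈ C

/-- The dual cone `C* = {ξ : ⟨ξ,y⟩ ≥ 0 for all y ∈ C}`. -/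
def dualCone {n : ℕ} (C : Set (Fin n → ℝ)) : Set (Fin n → ℝ) :=
  {ξ | ∀ y ∈ C, 0 ≤ ∑ i, ξ i * y i}

/-- `C′ ⋐ C`: the cone `C′` is compact in the cone `C`, i.e. the projection
`(closure C′) ∩ S^{n−1}` is contained in `C ∩ S^{n−1}`. -/
def CmpSub {n : ℕ} (C' C : Set (Fin n → ℝ)) : Prop :=
  IsCone C' ∧ closure C' ∩ {y | en y = 1} ⊆ C ∩ {y | en y = 1}

/-- The Fourier–Laplace transform
`f(z) = (2π)^{−n} (−iz)^γ ∫ e^{k|ξ|₁} g(ξ) e^{i⟨ξ,z⟩} dξ` of the distribution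
`V = D^γ[e^{k|ξ|₁} g(ξ)]`. -/
def FL {n : ℕ} (k : ℝ) (γ : Fin n → ℕ) (g : (Fin n → ℝ) → ℂ) (z : Fin n → ℂ) : ℂ :=
  (((2 * Real.pi) ^ n : ℝ) : ℂ)⁻¹ * (∏ j, (-Complex.I * z j) ^ γ j) *
    ∫ ξ : Fin n → ℝ,
      (Real.exp (k * n1 ξ) : ℂ) * g ξ * Complex.exp (Complex.I * ∑ i, (ξ i : ℂ) * z i)

theorem integrable_exp_neg_abs : Integrable (fun x : ℝ => Real.exp (-|x|)) := by
  rw [← integrableOn_univ, ← Set.Iic_union_Ioi (a := (0 : ℝ))]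
  refine IntegrableOn.union ?_ ?_
  · refine (integrableOn_exp_Iic 0).congr_fun (fun x hx => ?_) measurableSet_Iic
    simp [abs_of_nonpos (Set.mem_Iic.1 hx)]
  · refine (integrableOn_exp_neg_Ioi 0).congr_fun (fun x hx => ?_) measurableSet_Ioi
    simp [abs_of_pos (Set.mem_Ioi.1 hx)]

theorem integrable_exp_neg_n1 (n : ℕ) :
    Integrable (fun ξ : Fin n → ℝ => Real.exp (-n1 ξ)) := by
  have h := Integrable.fintype_prod (ι := Fin n) (μ := fun _ => (volume : Measure ℝ))
    (f := fun _ x => Real.exp (-|x|)) fun _ => integrable_exp_neg_abs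
  simpa only [n1, ← Real.exp_sum, Finset.sum_neg_distrib, ← volume_pi] using h

theorem n1_nonneg {n : ℕ} (ξ : Fin n → ℝ) : 0 ≤ n1 ξ :=
  Finset.sum_nonneg fun _ _ => abs_nonneg _

theorem n1_le_mul_en {n : ℕ} (ξ : Fin n → ℝ) : n1 ξ ≤ n * en ξ := by
  have h : ∀ i ∈ Finset.univ, |ξ i| ≤ en ξ := fun i hi =>
    Real.abs_le_sqrt (Finset.single_le_sum (f := fun i => ξ i ^ 2) (fun _ _ => sq_nonneg _) hi)
  simpa [n1] using Finset.sum_le_sum h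

theorem norm_le_cnorm {n : ℕ} (z : Fin n → ℂ) (i : Fin n) : ‖z i‖ ≤ cnorm z :=
  Real.le_sqrt_of_sq_le
    (Finset.single_le_sum (f := fun i => ‖z i‖ ^ 2) (fun _ _ => sq_nonneg _) (Finset.mem_univ i))

theorem norm_prod_pow_le {n : ℕ} (γ : Fin n → ℕ) (z : Fin n → ℂ) :
    ‖∏ j, (-Complex.I * z j) ^ γ j‖ ≤ (1 + cnorm z) ^ mOrd γ := by
  rw [norm_prod, mOrd, ← Finset.prod_pow_eq_pow_sum]
  refine Finset.prod_le_prod (fun _ _ => norm_nonneg _) fun j _ => ?_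
  rw [norm_pow, norm_mul, norm_neg, Complex.norm_I, one_mul]
  exact pow_le_pow_left₀ (norm_nonneg _) (by linarith [norm_le_cnorm z j]) _

/-- The integrand of the Fourier–Laplace transform. -/
def kernelFL {n : ℕ} (k : ℝ) (g : (Fin n → ℝ) → ℂ) (z : Fin n → ℂ) (ξ : Fin n → ℝ) : ℂ :=
  (Real.exp (k * n1 ξ) : ℂ) * g ξ * Complex.exp (Complex.I * ∑ i, (ξ i : ℂ) * z i)

/-- The complex linear form `z ↦ ⟨ξ,z⟩`. -/
def pairing {n : ℕ} (ξ : Fin n → ℝ) : (Fin n → ℂ) →L[ℂ] ℂ :=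
  ∑ i, (ξ i : ℂ) • ContinuousLinearMap.proj (R := ℂ) (φ := fun _ : Fin n => ℂ) i

theorem pairing_apply {n : ℕ} (ξ : Fin n → ℝ) (z : Fin n → ℂ) :
    pairing ξ z = ∑ i, (ξ i : ℂ) * z i := by
  simp [pairing]

theorem norm_pairing_le {n : ℕ} (ξ : Fin n → ℝ) : ‖pairing ξ‖ ≤ n1 ξ := by
  refine ContinuousLinearMap.opNorm_le_bound _ (n1_nonneg ξ) fun z => ?_
  rw [pairing_apply, n1, Finset.sum_mul]
  refine (norm_sum_le _ _).trans (Finset.sum_le_sum fun i _ => ?_)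
  rw [norm_mul, Complex.norm_real, Real.norm_eq_abs]
  exact mul_le_mul_of_nonneg_left (norm_le_pi_norm z i) (abs_nonneg _)

theorem continuous_n1 {n : ℕ} : Continuous (n1 : (Fin n → ℝ) → ℝ) := by
  unfold n1
  fun_prop

theorem continuous_pairing {n : ℕ} : Continuous (pairing : (Fin n → ℝ) → _) := by
  unfold pairing
  fun_prop

theorem continuous_kernelFL {n : ℕ} (k : ℝ) {g : (Fin n → ℝ) → ℂ} (hg : Continuous g)
    (z : Fin n → ℂ) : Continuous (kernelFL k g z) := by
  have := continuous_n1 (n := n)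
  unfold kernelFL
  fun_prop

theorem hasFDerivAt_kernelFL {n : ℕ} (k : ℝ) (g : (Fin n → ℝ) → ℂ) (ξ : Fin n → ℝ)
    (z : Fin n → ℂ) :
    HasFDerivAt (fun w => kernelFL k g w ξ)
      ((kernelFL k g z ξ * Complex.I) • pairing ξ) z := by
  have h := (((pairing ξ).hasFDerivAt (x := z)).const_mul Complex.I).cexp.const_mul
    ((Real.exp (k * n1 ξ) : ℂ) * g ξ)
  simpa only [pairing_apply, kernelFL, smul_smul, mul_assoc] using h

theorem norm_kernelFL_le {n : ℕ} {k B : ℝ} {g : (Fin n → ℝ) → ℂ} (hB : ∀ ξ, ‖g ξ‖ ≤ B)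
    {z : Fin n → ℂ} {ξ : Fin n → ℝ}
    (h : g ξ ≠ 0 → (k + 2) * n1 ξ ≤ ∑ i, ξ i * imv z i) :
    ‖kernelFL k g z ξ‖ ≤ B * Real.exp (-(2 * n1 ξ)) := by
  have hB0 : 0 ≤ B := (norm_nonneg _).trans (hB ξ)
  by_cases hg : g ξ = 0
  · simp only [kernelFL, hg, mul_zero, zero_mul, norm_zero]
    positivity
  · have hre : (Complex.I * ∑ i, (ξ i : ℂ) * z i).re = -∑ i, ξ i * imv z i := by
      simp [imv]
    rw [kernelFL, norm_mul, norm_mul, Complex.norm_exp, hre, Complex.norm_real,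
      Real.norm_eq_abs, Real.abs_exp, mul_comm (Real.exp _), mul_assoc, ← Real.exp_add]
    refine mul_le_mul (hB ξ) (Real.exp_le_exp.2 ?_) (Real.exp_pos _).le hB0
    linarith [h hg]

theorem norm_fderiv_kernelFL_le {n : ℕ} {k B : ℝ} {g : (Fin n → ℝ) → ℂ}
    (hB : ∀ ξ, ‖g ξ‖ ≤ B) {z : Fin n → ℂ} {ξ : Fin n → ℝ}
    (h : g ξ ≠ 0 → (k + 2) * n1 ξ ≤ ∑ i, ξ i * imv z i) :
    ‖(kernelFL k g z ξ * Complex.I) • pairing ξ‖ ≤ B * Real.exp (-n1 ξ) := by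
  have hB0 : 0 ≤ B := (norm_nonneg _).trans (hB ξ)
  rw [norm_smul, norm_mul, Complex.norm_I, mul_one]
  have hexp : n1 ξ ≤ Real.exp (n1 ξ) := by linarith [Real.add_one_le_exp (n1 ξ)]
  calc ‖kernelFL k g z ξ‖ * ‖pairing ξ‖
      ≤ (B * Real.exp (-(2 * n1 ξ))) * Real.exp (n1 ξ) :=
        mul_le_mul (norm_kernelFL_le hB h) ((norm_pairing_le ξ).trans hexp) (norm_nonneg _)
          (by positivity)
    _ = B * Real.exp (-n1 ξ) := by
        rw [mul_assoc, ← Real.exp_add]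
        ring_nf

theorem sum_mul_imv_sub_le {n : ℕ} (ξ : Fin n → ℝ) (z w : Fin n → ℂ) :
    ∑ i, ξ i * imv z i - n1 ξ * ‖w - z‖ ≤ ∑ i, ξ i * imv w i := by
  rw [n1, Finset.sum_mul, ← Finset.sum_sub_distrib]
  refine Finset.sum_le_sum fun i _ => ?_
  have h : |imv w i - imv z i| ≤ ‖w - z‖ :=
    (Complex.abs_im_le_norm ((w - z) i)).trans (norm_le_pi_norm (w - z) i)
  have h2 := mul_le_mul_of_nonneg_left h (abs_nonneg (ξ i))
  rw [← abs_mul] at h2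
  linarith [neg_abs_le (ξ i * (imv w i - imv z i))]

/-- The Fourier–Laplace transform of a distribution of exponential
growth supported in `C*` is well defined and holomorphic on a truncated tube over any
`C′ ⋐ C`, with polynomial growth of order `|γ|`. -/
theorem stmt_11 {n : ℕ} (C C' : Set (Fin n → ℝ))
    (hCo : IsOpen C) (hCc : Convex ℝ C) (hCcone : IsCone C)
    (hsub : CmpSub C' C)
    (δ : ℝ) (hδ : 0 < δ)
    (hsep : ∀ ξ ∈ dualCone C, ∀ y ∈ C', δ * (en ξ * en y) ≤ ∑ i, ξ i * y i)
    (k : ℝ) (hk : 0 ≤ k) (γ : Fin n → ℕ)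
    (g : (Fin n → ℝ) → ℂ) (hgc : Continuous g) (hgb : ∃ M : ℝ, ∀ ξ, ‖g ξ‖ ≤ M)
    (hsupp : Function.support g ⊆ dualCone C) :
    ∃ r : ℝ, 0 < r ∧
      (∀ z : Fin n → ℂ, imv z ∈ C' → r ≤ en (imv z) →
        Integrable (fun ξ : Fin n → ℝ =>
          (Real.exp (k * n1 ξ) : ℂ) * g ξ * Complex.exp (Complex.I * ∑ i, (ξ i : ℂ) * z i))) ∧
      DifferentiableOn ℂ (FL k γ g) {z | imv z ∈ C' ∧ r ≤ en (imv z)} ∧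
      ∃ M : ℝ, 0 < M ∧ ∀ z : Fin n → ℂ, imv z ∈ C' → r ≤ en (imv z) →
        ‖FL k γ g z‖ ≤ M * (1 + cnorm z) ^ mOrd γ := by
  obtain ⟨B, hB⟩ := hgb
  have hB0 : 0 ≤ B := (norm_nonneg _).trans (hB 0)
  set r : ℝ := n * (k + 3) / δ + 1
  have hr : 0 < r := by positivity
  have hrδ : n * (k + 3) ≤ δ * r := by
    have : δ * r = n * (k + 3) + δ := by simp only [r]; field_simp
    linarith
  have hlow : ∀ z, imv z ∈ C' → r ≤ en (imv z) → ∀ ξ, g ξ ≠ 0 →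
      (k + 3) * n1 ξ ≤ ∑ i, ξ i * imv z i := by
    intro z hz hrz ξ hξ
    have hen : 0 ≤ en ξ := Real.sqrt_nonneg _
    calc (k + 3) * n1 ξ ≤ (k + 3) * (n * en ξ) :=
          mul_le_mul_of_nonneg_left (n1_le_mul_en ξ) (by positivity)
      _ = n * (k + 3) * en ξ := by ring
      _ ≤ δ * r * en ξ := mul_le_mul_of_nonneg_right hrδ hen
      _ ≤ δ * en (imv z) * en ξ := by gcongr
      _ = δ * (en ξ * en (imv z)) := by ring
      _ ≤ _ := hsep ξ (hsupp hξ) _ hz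
  have hnear : ∀ z, imv z ∈ C' → r ≤ en (imv z) → ∀ w ∈ Metric.ball z 1, ∀ ξ, g ξ ≠ 0 →
      (k + 2) * n1 ξ ≤ ∑ i, ξ i * imv w i := by
    intro z hz hrz w hw ξ hξ
    have h1 := sum_mul_imv_sub_le ξ z w
    have h2 := hlow z hz hrz ξ hξ
    have h3 := mul_le_mul_of_nonneg_left (mem_ball_iff_norm.1 hw).le (n1_nonneg ξ)
    linarith
  have hself : ∀ z : Fin n → ℂ, z ∈ Metric.ball z 1 := fun z => Metric.mem_ball_self one_pos
  have hdom := (integrable_exp_neg_n1 n).const_mul B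
  have hbd : ∀ z, imv z ∈ C' → r ≤ en (imv z) → ∀ ξ,
      ‖kernelFL k g z ξ‖ ≤ B * Real.exp (-n1 ξ) := by
    intro z hz hrz ξ
    refine (norm_kernelFL_le hB (hnear z hz hrz z (hself z) ξ)).trans ?_
    gcongr
    linarith [n1_nonneg ξ]
  have hint : ∀ z, imv z ∈ C' → r ≤ en (imv z) → Integrable (kernelFL k g z) := fun z hz hrz =>
    hdom.mono' (continuous_kernelFL k hgc z).aestronglyMeasurable (.of_forall (hbd z hz hrz))
  refine ⟨r, hr, hint, ?_, ?_⟩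
  · rintro z ⟨hz, hrz⟩
    have hI : HasFDerivAt (fun w => ∫ ξ, kernelFL k g w ξ) _ z :=
      hasFDerivAt_integral_of_dominated_of_fderiv_le
        (F' := fun w ξ => (kernelFL k g w ξ * Complex.I) • pairing ξ)
        (Metric.ball_mem_nhds z one_pos)
        (.of_forall fun w => (continuous_kernelFL k hgc w).aestronglyMeasurable)
        (hint z hz hrz)
        (((continuous_kernelFL k hgc z).mul continuous_const).smul
          continuous_pairing).aestronglyMeasurable
        (.of_forall fun ξ w hw => norm_fderiv_kernelFL_le hB (hnear z hz hrz w hw ξ))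
        hdom
        (.of_forall fun ξ w _ => hasFDerivAt_kernelFL k g ξ w)
    have hP : DifferentiableAt ℂ
        (fun w : Fin n → ℂ => (((2 * Real.pi) ^ n : ℝ) : ℂ)⁻¹ *
          ∏ j, (-Complex.I * w j) ^ γ j) z := by
      fun_prop
    exact (hP.mul hI.differentiableAt).differentiableWithinAt
  · set J : ℝ := ∫ ξ : Fin n → ℝ, B * Real.exp (-n1 ξ)
    have hJ : 0 ≤ J := integral_nonneg fun ξ => by positivity
    set c : ℝ := ‖(((2 * Real.pi) ^ n : ℝ) : ℂ)⁻¹‖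
    have hc : 0 ≤ c := norm_nonneg _
    refine ⟨c * J + 1, by positivity, fun z hz hrz => ?_⟩
    have hz0 : 0 ≤ cnorm z := Real.sqrt_nonneg _
    have h1 : ‖∫ ξ, kernelFL k g z ξ‖ ≤ J :=
      norm_integral_le_of_norm_le hdom (.of_forall (hbd z hz hrz))
    calc ‖FL k γ g z‖ = c * ‖∏ j, (-Complex.I * z j) ^ γ j‖ * ‖∫ ξ, kernelFL k g z ξ‖ := by
          rw [← norm_mul, ← norm_mul]
          rfl
      _ ≤ c * (1 + cnorm z) ^ mOrd γ * J := by
          gcongr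
          exact norm_prod_pow_le γ z
      _ = c * J * (1 + cnorm z) ^ mOrd γ := by ring
      _ ≤ (c * J + 1) * (1 + cnorm z) ^ mOrd γ := by
          gcongr
          linarith
end
end

section
/- Identity theorem across a real open set in several complex variables: let U ⊂ ℂⁿ be a connected open set such that U ∩ ℝⁿ contains a nonempty open subset X of ℝⁿ (ℝⁿ embedded as the real points of ℂⁿ). If F : U → ℂ is holomorphic on U and F(x) = 0 for every x ∈ X, then F vanishes identically on U. -/
open Complex Topology

noncomputable section

/-- A function holomorphic on an open convex set whose restriction to a complex line has zeros
accumulating at a point of the set vanishes on the part of the line inside the set. -/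
theorem eq_zero_of_frequently_eq_zero_on_line {E : Type*} [NormedAddCommGroup E]
    [NormedSpace ℂ E] [NormedSpace ℝ E] [IsScalarTower ℝ ℂ E] {B : Set E} (hBo : IsOpen B)
    (hBc : Convex ℝ B) {F : E → ℂ} (hF : DifferentiableOn ℂ F B) {x v : E} {c : ℂ}
    (hx : x ∈ B) (hc : x + c • v ∈ B)
    (h : ∃ᶠ t : ℂ in 𝓝[≠] 0, F (x + t • v) = 0) : F (x + c • v) = 0 := by
  have hd : Differentiable ℂ fun t : ℂ => x + t • v := by fun_prop
  have ho : IsOpen ((fun t : ℂ => x + t • v) ⁻¹' B) := hBo.preimage hd.continuous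
  have hconv : Convex ℝ ((fun t : ℂ => x + t • v) ⁻¹' B) := by
    intro s hs t ht a b ha hb hab
    have key := hBc hs ht ha hb hab
    have : x + (a • s + b • t) • v = a • (x + s • v) + b • (x + t • v) := by
      rw [smul_add, smul_add, add_smul, smul_assoc, smul_assoc, add_add_add_comm, ← add_smul,
        hab, one_smul]
    simpa only [Set.mem_preimage, this] using key
  have hg : AnalyticOnNhd ℂ (fun t : ℂ => F (x + t • v)) ((fun t : ℂ => x + t • v) ⁻¹' B) :=
    (hF.comp hd.differentiableOn fun _ ht => ht).analyticOnNhd ho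
  exact hg.eqOn_zero_of_preconnected_of_frequently_eq_zero hconv.isPreconnected
    (z₀ := 0) (by simpa using hx) h hc

/-- A holomorphic function on an open convex set which vanishes near one point of the set
vanishes on the whole set. -/
theorem eqOn_zero_of_convex_of_eventually_eq_zero {E : Type*} [NormedAddCommGroup E]
    [NormedSpace ℂ E] [NormedSpace ℝ E] [IsScalarTower ℝ ℂ E] {B : Set E} (hBo : IsOpen B)
    (hBc : Convex ℝ B) {F : E → ℂ} (hF : DifferentiableOn ℂ F B) {w : E} (hw : w ∈ B)
    (h : ∀ᶠ z in 𝓝 w, F z = 0) : ∀ z ∈ B, F z = 0 := by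
  intro z hz
  have hcont : Filter.Tendsto (fun t : ℂ => w + t • (z - w)) (𝓝 0) (𝓝 w) := by
    have : Continuous fun t : ℂ => w + t • (z - w) := by fun_prop
    simpa using this.tendsto 0
  have := eq_zero_of_frequently_eq_zero_on_line (v := z - w) (c := 1) hBo hBc hF hw
    (by simpa using hz) ((hcont.eventually h).filter_mono nhdsWithin_le_nhds).frequently
  simpa using this

/-- A holomorphic function on a preconnected open set which vanishes near one point of the set
vanishes on the whole set. -/
theorem eqOn_zero_of_isPreconnected_of_eventually_eq_zero {E : Type*} [NormedAddCommGroup E]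
    [NormedSpace ℂ E] {U : Set E} (hUo : IsOpen U) (hUc : IsPreconnected U) {F : E → ℂ}
    (hF : DifferentiableOn ℂ F U) {w : E} (hw : w ∈ U) (h : ∀ᶠ z in 𝓝 w, F z = 0) :
    ∀ z ∈ U, F z = 0 := by
  let _ : NormedSpace ℝ E := NormedSpace.restrictScalars ℝ ℂ E
  have : IsScalarTower ℝ ℂ E := IsScalarTower.of_algebraMap_smul fun _ _ => rfl
  have hsub : U ⊆ {z | ∀ᶠ y in 𝓝 z, F y = 0} := by
    refine hUc.subset_of_closure_inter_subset isOpen_setOfPred_eventually_nhds ⟨w, hw, h⟩ ?_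
    rintro z ⟨hz, hzU⟩
    obtain ⟨r, hr, hrU⟩ := Metric.isOpen_iff.1 hUo z hzU
    obtain ⟨y, hy, hyz⟩ := Metric.mem_closure_iff.1 hz r hr
    filter_upwards [Metric.ball_mem_nhds z hr] with u hu
    exact eqOn_zero_of_convex_of_eventually_eq_zero Metric.isOpen_ball (convex_ball z r)
      (hF.mono hrU) (Metric.mem_ball'.2 hyz) hy u hu
  exact fun z hz => (hsub hz).self_of_nhds

/-- A function holomorphic near a real point and vanishing at all nearby real points vanishes
in a complex neighbourhood of that point. -/
theorem eventually_eq_zero_of_eventually_eq_zero_ofReal {ι : Type*} [Fintype ι]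
    {U : Set (ι → ℂ)} (hUo : IsOpen U) {F : (ι → ℂ) → ℂ} (hF : DifferentiableOn ℂ F U)
    {x₀ : ι → ℝ} (hx₀ : (fun i => (x₀ i : ℂ)) ∈ U)
    (h : ∀ᶠ x in 𝓝 x₀, F (fun i => (x i : ℂ)) = 0) :
    ∀ᶠ z in 𝓝 (fun i => (x₀ i : ℂ)), F z = 0 := by
  obtain ⟨r, hr, hrU⟩ := Metric.isOpen_iff.1 hUo _ hx₀
  have hre : Filter.Tendsto (fun (z : ι → ℂ) i => (z i).re) (𝓝 fun i => (x₀ i : ℂ)) (𝓝 x₀) := by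
    have : Continuous fun (z : ι → ℂ) i => (z i).re := by fun_prop
    simpa using this.tendsto fun i => (x₀ i : ℂ)
  have hcoe : Continuous fun (x : ι → ℝ) i => (x i : ℂ) := by fun_prop
  filter_upwards [Metric.ball_mem_nhds _ hr, hre.eventually h.eventually_nhds,
    hre.eventually ((hcoe.tendsto x₀).eventually (Metric.ball_mem_nhds _ hr))] with z hz hzero hzre
  have hdecomp : (fun i => ((z i).re : ℂ)) + I • (fun i => ((z i).im : ℂ)) = z := by
    funext i
    simp [mul_comm I]
  rw [← hdecomp]
  refine eq_zero_of_frequently_eq_zero_on_line Metric.isOpen_ball (convex_ball _ r)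
    (hF.mono hrU) hzre (by rwa [hdecomp]) ?_
  have hline : Filter.Tendsto (fun t : ℝ => fun i => (z i).re + t * (z i).im) (𝓝 0)
      (𝓝 fun i => (z i).re) := by
    have : Continuous fun t : ℝ => fun i => (z i).re + t * (z i).im := by fun_prop
    simpa using this.tendsto 0
  have hofReal : Filter.Tendsto (fun t : ℝ => (t : ℂ)) (𝓝[≠] 0) (𝓝[≠] 0) := by
    refine tendsto_nhdsWithin_iff.2 ⟨?_, ?_⟩
    · simpa using (continuous_ofReal.tendsto 0).mono_left nhdsWithin_le_nhds
    · filter_upwards [self_mem_nhdsWithin] with t ht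
      simpa using ht
  refine hofReal.frequently (Filter.Eventually.frequently ?_)
  filter_upwards [(hline.eventually hzero).filter_mono nhdsWithin_le_nhds] with t ht
  rw [← ht]
  congr 1
  funext i
  simp

/-- Identity theorem across a real open set in several complex
variables: a holomorphic function on a connected open set `U ⊂ ℂⁿ` which vanishes on a
nonempty open subset `X` of the real points contained in `U` vanishes identically. -/
theorem stmt_17 {n : ℕ} (U : Set (Fin n → ℂ)) (hUo : IsOpen U) (hUc : IsConnected U)
    (X : Set (Fin n → ℝ)) (hXne : X.Nonempty) (hXo : IsOpen X)
    (hXU : (fun x : Fin n → ℝ => fun i => (x i : ℂ)) '' X ⊆ U)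
    (F : (Fin n → ℂ) → ℂ) (hF : DifferentiableOn ℂ F U)
    (hFX : ∀ x ∈ X, F (fun i => (x i : ℂ)) = 0) :
    ∀ z ∈ U, F z = 0 := by
  obtain ⟨x₀, hx₀⟩ := hXne
  have hx₀U : (fun i => (x₀ i : ℂ)) ∈ U := hXU ⟨x₀, hx₀, rfl⟩
  exact eqOn_zero_of_isPreconnected_of_eventually_eq_zero hUo hUc.isPreconnected hF hx₀U
    (eventually_eq_zero_of_eventually_eq_zero_ofReal hUo hF hx₀U
      (Filter.eventually_of_mem (hXo.mem_nhds hx₀) hFX))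
end
end
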